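/- arXiv:2209.03717 — 5 statements merged into one kernel-verified Lean document; each statement's English description precedes it below -/
import Mathlib

section
/- If w ∈ S_n is an inverse shuffle, then its inversion number satisfies inv(w) = Σ_{i=1}^{n−1} (w⁻¹(i) − i). -/
/-- The inversions of `w`, counted by the smaller of the two values. -/
theorem card_inversions_eq_sum {n : ℕ} (w : Equiv.Perm (Fin n)) :
    (Finset.univ.filter
        (fun p : Fin n × Fin n => p.1 < p.2 ∧ w p.2 < w p.1)).card =
      ∑ i, (Finset.univ.filter (fun k : Fin n => w⁻¹ k < w⁻¹ i ∧ i < k)).card := by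
  simp only [Finset.card_filter]
  rw [Fintype.sum_prod_type_right, ← Equiv.sum_comp w⁻¹]
  refine Finset.sum_congr rfl fun i _ => ?_
  rw [← Equiv.sum_comp w⁻¹]
  simp

theorem card_filter_perm_lt {n : ℕ} (σ : Equiv.Perm (Fin n)) (a : Fin n) :
    (Finset.univ.filter (fun k : Fin n => σ k < a)).card = a := by
  rw [Finset.card_filter, Equiv.sum_comp σ (fun k => if k < a then 1 else 0),
    ← Finset.card_filter, Finset.filter_gt_eq_Iio, Fin.card_Iio]

/-- If `σ` preserves the order of `i` with every smaller value, then the values larger than `i`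
that `σ` sends below `σ i` account for the displacement of `i`. -/
theorem card_filter_perm_lt_and_lt {n : ℕ} (σ : Equiv.Perm (Fin n)) (i : Fin n)
    (h : ∀ k < i, σ k < σ i) :
    ((Finset.univ.filter (fun k : Fin n => σ k < σ i ∧ i < k)).card : ℤ) =
      ((σ i : ℕ) : ℤ) - ((i : ℕ) : ℤ) := by
  have hsplit := Finset.card_filter_add_card_filter_not
    (s := Finset.univ.filter (fun k : Fin n => σ k < σ i)) (fun k => i < k)
  have hsmall : (Finset.univ.filter (fun k : Fin n => σ k < σ i ∧ ¬ i < k)) =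
      Finset.Iio i := by
    ext k
    simp only [Finset.mem_filter, Finset.mem_univ, true_and, Finset.mem_Iio, not_lt]
    refine ⟨fun hk => lt_of_le_of_ne hk.2 ?_, fun hk => ⟨h k hk, hk.le⟩⟩
    rintro rfl
    exact lt_irrefl _ hk.1
  rw [Finset.filter_filter, Finset.filter_filter, hsmall, Fin.card_Iio,
    card_filter_perm_lt] at hsplit
  lia


/-- If `w ∈ S_n` is an inverse shuffle, then its inversion number
satisfies `inv(w) = Σ_{i=1}^{n−1} (w⁻¹(i) − i)`.  We model `S_n` as
`Equiv.Perm (Fin n)` (0-indexed), so the sum runs over the `i : Fin n` with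
`(i : ℕ) < n - 1`, and the summands are computed in `ℤ`. -/
theorem stmt_3 (n : ℕ) (hn : 1 ≤ n) (w : Equiv.Perm (Fin n))
    (hw : ∀ i j : Fin n, (i : ℕ) < (j : ℕ) → (j : ℕ) < n - 1 → w⁻¹ i < w⁻¹ j) :
    ((Finset.univ.filter
        (fun p : Fin n × Fin n => p.1 < p.2 ∧ w p.2 < w p.1)).card : ℤ) =
      ∑ i ∈ Finset.univ.filter (fun i : Fin n => (i : ℕ) < n - 1),
        ((((w⁻¹ i : Fin n) : ℕ) : ℤ) - ((i : ℕ) : ℤ)) := by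
  rw [card_inversions_eq_sum, Nat.cast_sum]
  symm
  rw [Finset.sum_filter]
  refine Finset.sum_congr rfl fun i _ => ?_
  split_ifs with hi
  · exact (card_filter_perm_lt_and_lt w⁻¹ i fun k hk => hw k i hk hi).symm
  · symm
    rw [Nat.cast_eq_zero, Finset.card_eq_zero, Finset.filter_eq_empty_iff]
    rintro k - ⟨-, hk⟩
    lia
end

section
/- Let A be a commutative ring and B a commutative A-algebra that is finite and free as an A-module. Then the following are equivalent: (i) the A-linear map B → Hom_A(B, A) sending b to the functional x ↦ Tr_{B/A}(bx) is bijective (B is 'separable' over A); (ii) the module of Kähler differentials Ω¹_{B/A} is zero (B is unramified over A); (iii) B is an étale A-algebra (equivalently, B is formally étale over A). -/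
universe u

open TensorProduct Module

namespace Algebra

variable {R S ι : Type*} [CommRing R] [CommRing S] [Algebra R S]

theorem trace_eq_sum_repr_mul [Fintype ι] (b : Basis ι R S) (s : S) :
    trace R S s = ∑ i, b.repr (s * b i) i := by
  classical
  rw [trace_eq_matrix_trace b, Matrix.trace]
  simp [leftMulMatrix_eq_repr_mul]

/-- The map `S ⊗ S → S` contracting the right factor along a functional `l`. -/
noncomputable def contractRight (l : S →ₗ[R] R) : S ⊗[R] S →ₗ[R] S :=
  (_root_.TensorProduct.rid R S).toLinearMap ∘ₗ l.lTensor S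

@[simp]
theorem contractRight_tmul (l : S →ₗ[R] R) (x y : S) : contractRight l (x ⊗ₜ y) = l y • x := by
  simp [contractRight]

theorem contractRight_tmul_one_mul (l : S →ₗ[R] R) (x : S) (w : S ⊗[R] S) :
    contractRight l ((x ⊗ₜ[R] (1 : S)) * w) = x * contractRight l w := by
  induction w with
  | zero => simp
  | tmul a c => simp
  | add u v hu hv => rw [mul_add, map_add, map_add, hu, hv, mul_add]

theorem sum_contractRight_coord_mul [Fintype ι] (b : Basis ι R S) (w : S ⊗[R] S) :
    ∑ i, contractRight (b.coord i) (((1 : S) ⊗ₜ[R] b i) * w) = contractRight (trace R S) w := by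
  induction w with
  | zero => simp
  | tmul x y => simp [trace_eq_sum_repr_mul b, Finset.sum_smul, mul_comm y]
  | add u v hu hv => simp only [mul_add, map_add, Finset.sum_add_distrib, hu, hv]

theorem sum_mul_contractRight_coord [Fintype ι] (b : Basis ι R S) (w : S ⊗[R] S) :
    ∑ i, b i * contractRight (b.coord i) w = TensorProduct.lmul' R w := by
  induction w with
  | zero => simp
  | tmul x y =>
    conv_rhs => rw [TensorProduct.lmul'_apply_tmul, ← b.sum_repr y, Finset.mul_sum]
    simp [mul_comm x]
  | add u v hu hv => simp only [mul_add, map_add, Finset.sum_add_distrib, hu, hv]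

/-- Contracting a separability element `t = ∑ aᵢ ⊗ cᵢ` along the trace gives
`∑ Tr(x cᵢ) aᵢ = x` for every `x`. -/
theorem contractRight_trace_mul [Module.Finite R S] [Module.Free R S] {t : S ⊗[R] S}
    (ht : ∀ s, ((1 : S) ⊗ₜ[R] s - s ⊗ₜ[R] (1 : S)) * t = 0)
    (ht' : TensorProduct.lmul' R t = 1) (x : S) :
    contractRight (trace R S) (((1 : S) ⊗ₜ[R] x) * t) = x := by
  have ht (s : S) : ((1 : S) ⊗ₜ[R] s) * t = (s ⊗ₜ[R] (1 : S)) * t := by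
    rw [← sub_eq_zero, ← sub_mul, ht]
  rw [ht, contractRight_tmul_one_mul, ← sum_contractRight_coord_mul (Free.chooseBasis R S)]
  simp_rw [ht, contractRight_tmul_one_mul]
  rw [sum_mul_contractRight_coord, ht', mul_one]

theorem bijective_traceForm_of_formallyUnramified [Module.Finite R S] [Module.Free R S]
    [FormallyUnramified R S] : Function.Bijective (traceForm R S) := by
  obtain ⟨t, ht, ht'⟩ := FormallyUnramified.iff_exists_tensorProduct.mp ‹FormallyUnramified R S›
  refine ⟨(injective_iff_map_eq_zero _).mpr fun x hx ↦ ?_, fun l ↦ ?_⟩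
  · have key (w : S ⊗[R] S) :
        contractRight (trace R S) (((1 : S) ⊗ₜ[R] x) * w) = 0 := by
      induction w with
      | zero => simp
      | tmul a c => simp [← traceForm_apply, hx]
      | add u v hu hv => rw [mul_add, map_add, hu, hv, add_zero]
    rw [← contractRight_trace_mul ht ht' x, key]
  · refine ⟨contractRight l (TensorProduct.comm R S S t), LinearMap.ext fun x ↦ ?_⟩
    have key (w : S ⊗[R] S) :
        trace R S (contractRight l (TensorProduct.comm R S S w) * x) =
          l (contractRight (trace R S) (((1 : S) ⊗ₜ[R] x) * w)) := by
      induction w with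
      | zero => simp
      | tmul a c => simp [mul_comm]
      | add u v hu hv => simp only [mul_add, add_mul, map_add, hu, hv]
    rw [traceForm_apply, key, contractRight_trace_mul ht ht']

theorem formallyUnramified_of_bijective_traceForm [Module.Finite R S] [Module.Free R S]
    (h : Function.Bijective (traceForm R S)) : FormallyUnramified R S := by
  let b := Free.chooseBasis R S
  choose e he using fun i ↦ h.2 (b.coord i)
  have he (i : Free.ChooseBasisIndex R S) (x : S) : trace R S (e i * x) = b.repr x i := by
    rw [← traceForm_apply, he, b.coord_apply]
  refine FormallyUnramified.iff_exists_tensorProduct.mpr ⟨∑ i, e i ⊗ₜ b i, fun x ↦ ?_, ?_⟩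
  · have key (j : Free.ChooseBasisIndex R S) : ∑ i, b.repr (x * b i) j • e i = x * e j := by
      classical
      refine h.1 (b.ext fun k ↦ ?_)
      rw [traceForm_apply, traceForm_apply, mul_comm x, mul_assoc, he]
      simp [Finset.sum_mul, he, Finsupp.single_apply]
    rw [sub_mul, sub_eq_zero, Finset.mul_sum, Finset.mul_sum]
    simp only [TensorProduct.tmul_mul_tmul, one_mul]
    calc ∑ i, e i ⊗ₜ[R] (x * b i)
        = ∑ i, ∑ j, (b.repr (x * b i) j • e i) ⊗ₜ[R] b j := by
          refine Finset.sum_congr rfl fun i _ ↦ ?_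
          conv_lhs => rw [← b.sum_repr (x * b i)]
          simp only [tmul_sum, smul_tmul]
      _ = ∑ j, (x * e j) ⊗ₜ[R] b j := by
          rw [Finset.sum_comm]
          simp only [← sum_tmul, key]
  · refine h.1 (LinearMap.ext fun x ↦ ?_)
    rw [traceForm_apply, traceForm_apply, one_mul, trace_eq_sum_repr_mul b x]
    simp only [map_sum, TensorProduct.lmul'_apply_tmul, Finset.sum_mul, mul_assoc, he,
      mul_comm x]

end Algebra

/-- For a commutative `A`-algebra `B` that is finite free as an
`A`-module, the following are equivalent: (i) the trace-form map
`B → Hom_A(B, A)`, `b ↦ (x ↦ Tr_{B/A}(bx))`, is bijective (`B` is separable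
over `A`); (ii) `Ω¹_{B/A} = 0` (`B` is unramified over `A`); (iii) `B` is an
étale `A`-algebra. -/
theorem stmt_8 (A B : Type u) [CommRing A] [CommRing B] [Algebra A B]
    [Module.Finite A B] [Module.Free A B]
    (f : B →ₗ[A] (B →ₗ[A] A))
    (hf : ∀ b x : B, f b x = Algebra.trace A B (b * x)) :
    List.TFAE [Function.Bijective f,
      Subsingleton (Ω[B⁄A]),
      Algebra.Etale A B] := by
  obtain rfl : f = Algebra.traceForm A B := by
    ext b x
    rw [hf, Algebra.traceForm_apply]
  tfae_have 1 → 2 := fun h ↦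
    (Algebra.formallyUnramified_of_bijective_traceForm h).subsingleton_kaehlerDifferential
  tfae_have 2 → 3 := fun h ↦
    have : Algebra.FormallyUnramified A B := ⟨h⟩
    have : Module.FinitePresentation A B := Module.finitePresentation_of_projective A B
    have : Algebra.FinitePresentation A B := .of_finitePresentation A B
    Algebra.Etale.of_formallyUnramified_of_flat
  tfae_have 3 → 1 := fun _ ↦ Algebra.bijective_traceForm_of_formallyUnramified
  tfae_finish
end

section
/- For all 0 ≤ i ≤ j one has K^{i+1}(∧^j M) ⊆ K^i(∧^j M), and the quotient K^i(∧^j M)/K^{i+1}(∧^j M) is isomorphic as an R-module to (∧^i M') ⊗_R (∧^{j−i} M''). -/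
open ExteriorAlgebra

section KoszulFiltration

open TensorProduct GradedTensorProduct

/-- If `Q * P ≤ P * Q`, then a positive power of `P ⊔ Q` is contained in the corresponding power
of `Q` up to left multiples of `P`. -/
theorem Submodule.sup_pow_le {R A : Type*} [CommSemiring R] [Semiring A] [Algebra R A]
    (P Q : Submodule R A) (h : Q * P ≤ P * Q) (n : ℕ) :
    (P ⊔ Q) ^ (n + 1) ≤ Q ^ (n + 1) ⊔ P * (P ⊔ Q) ^ n := by
  induction n with
  | zero => simp [sup_comm]
  | succ n ih =>
    rw [pow_succ' (P ⊔ Q) (n + 1), Submodule.sup_mul]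
    refine sup_le le_sup_right ?_
    refine (mul_le_mul_right ih Q).trans ?_
    rw [Submodule.mul_sup]
    refine sup_le ?_ (le_sup_of_le_right ?_)
    · rw [← pow_succ']
      exact le_sup_left
    · calc Q * (P * (P ⊔ Q) ^ n) = Q * P * (P ⊔ Q) ^ n := (mul_assoc _ _ _).symm
        _ ≤ P * Q * (P ⊔ Q) ^ n := mul_le_mul_left h _
        _ = P * (Q * (P ⊔ Q) ^ n) := mul_assoc _ _ _
        _ ≤ P * ((P ⊔ Q) * (P ⊔ Q) ^ n) :=
          mul_le_mul_right (mul_le_mul_left le_sup_right _) P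
        _ = P * (P ⊔ Q) ^ (n + 1) := by rw [pow_succ']

variable {R M N L : Type*} [CommRing R] [AddCommGroup M] [AddCommGroup N] [AddCommGroup L]
  [Module R M] [Module R N] [Module R L]

namespace ExteriorAlgebra

/-- The images of two submodules of generators anticommute in the exterior algebra. -/
theorem map_ι_mul_map_ι_le (P Q : Submodule R M) :
    Q.map (ι R) * P.map (ι R) ≤ P.map (ι R) * Q.map (ι R) := by
  rw [Submodule.mul_le]
  rintro _ ⟨q, hq, rfl⟩ _ ⟨p, hp, rfl⟩
  rw [eq_neg_of_add_eq_zero_left (ι_add_mul_swap q p)]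
  exact neg_mem (Submodule.mul_mem_mul ⟨p, hp, rfl⟩ ⟨q, hq, rfl⟩)

theorem map_map_exteriorPower (f : M →ₗ[R] N) (n : ℕ) :
    (⋀[R]^n M).map (map f).toLinearMap = ((LinearMap.range f).map (ι R)) ^ n := by
  rw [exteriorPower, Submodule.map_pow, ι_range_map_map]

/-- The algebra morphism from the exterior algebra of `L` to the graded tensor product of
exterior algebras determined by a pair of linear maps on `L`. -/
noncomputable def toGradedTensorProduct (r : L →ₗ[R] M) (g : L →ₗ[R] N) :
    ExteriorAlgebra R L →ₐ[R]
      ((fun n : ℕ => ⋀[R]^n M) ᵍ⊗[R] (fun n : ℕ => ⋀[R]^n N)) :=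
  ExteriorAlgebra.lift R
    ⟨(includeLeft (fun n : ℕ => ⋀[R]^n M) (fun n : ℕ => ⋀[R]^n N)).toLinearMap ∘ₗ ι R ∘ₗ r +
      (includeRight (fun n : ℕ => ⋀[R]^n M) (fun n : ℕ => ⋀[R]^n N)).toLinearMap ∘ₗ ι R ∘ₗ g, by
      intro m
      have hM : ι R (r m) ∈ ⋀[R]^1 M := by simp [exteriorPower]
      have hN : ι R (g m) ∈ ⋀[R]^1 N := by simp [exteriorPower]
      have hswap := tmul_coe_mul_coe_tmul (fun n : ℕ => ⋀[R]^n M) (fun n : ℕ => ⋀[R]^n N)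
        1 ⟨_, hN⟩ ⟨_, hM⟩ 1
      have hmul := tmul_one_mul_one_tmul (fun n : ℕ => ⋀[R]^n M) (fun n : ℕ => ⋀[R]^n N)
        (ι R (r m)) (ι R (g m))
      have hl := (includeLeft (fun n : ℕ => ⋀[R]^n M) (fun n : ℕ => ⋀[R]^n N)).congr_arg
        (ι_sq_zero (R := R) (r m))
      have hr := (includeRight (fun n : ℕ => ⋀[R]^n M) (fun n : ℕ => ⋀[R]^n N)).congr_arg
        (ι_sq_zero (R := R) (g m))
      rw [map_mul, map_zero] at hl hr
      simp only [includeLeft_apply, includeRight_apply] at hl hr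
      simp only [one_mul, mul_one, uzpow_one, Units.neg_smul, one_smul] at hswap
      simp only [LinearMap.add_apply, LinearMap.comp_apply, AlgHom.toLinearMap_apply,
        includeLeft_apply, includeRight_apply]
      rw [add_mul, mul_add, mul_add, hl, hr, hswap, hmul]
      abel⟩

theorem toGradedTensorProduct_ι (r : L →ₗ[R] M) (g : L →ₗ[R] N) (x : L) :
    toGradedTensorProduct r g (ι R x) = ι R (r x) ᵍ⊗ₜ[R] 1 + 1 ᵍ⊗ₜ[R] ι R (g x) := by
  simp [toGradedTensorProduct]

theorem toGradedTensorProduct_map_left {r : L →ₗ[R] M} {g : L →ₗ[R] N} {f : M →ₗ[R] L}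
    (hr : r ∘ₗ f = .id) (hg : g ∘ₗ f = 0) (x : ExteriorAlgebra R M) :
    toGradedTensorProduct r g (map f x) = x ᵍ⊗ₜ[R] 1 := by
  suffices h : (toGradedTensorProduct r g).comp (map f) = includeLeft _ _ from
    DFunLike.congr_fun h x
  ext m
  have h₁ : r (f m) = m := LinearMap.congr_fun hr m
  have h₂ : g (f m) = 0 := LinearMap.congr_fun hg m
  simp [toGradedTensorProduct_ι, h₁, h₂]

theorem toGradedTensorProduct_map_right {r : L →ₗ[R] M} {g : L →ₗ[R] N} {s : N →ₗ[R] L}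
    (hr : r ∘ₗ s = 0) (hg : g ∘ₗ s = .id) (x : ExteriorAlgebra R N) :
    toGradedTensorProduct r g (map s x) = 1 ᵍ⊗ₜ[R] x := by
  suffices h : (toGradedTensorProduct r g).comp (map s) = includeRight _ _ from
    DFunLike.congr_fun h x
  ext m
  have h₁ : r (s m) = 0 := LinearMap.congr_fun hr m
  have h₂ : g (s m) = m := LinearMap.congr_fun hg m
  simp [toGradedTensorProduct_ι, h₁, h₂]

/-- The projection of the exterior algebra onto an exterior power. -/
noncomputable def projExteriorPower (R M : Type*) [CommRing R] [AddCommGroup M] [Module R M]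
    (n : ℕ) : ExteriorAlgebra R M →ₗ[R] ⋀[R]^n M :=
  DirectSum.component R ℕ (fun n => ⋀[R]^n M) n ∘ₗ
    (DirectSum.decomposeLinearEquiv (fun n : ℕ => ⋀[R]^n M)).toLinearMap

theorem projExteriorPower_coe {n : ℕ} (x : ⋀[R]^n M) :
    projExteriorPower R M n (x : ExteriorAlgebra R M) = x := by
  rw [projExteriorPower, LinearMap.comp_apply, LinearEquiv.coe_coe,
    DirectSum.decomposeLinearEquiv_apply, DirectSum.decompose_coe]
  exact DirectSum.of_eq_same (β := fun n : ℕ => ⋀[R]^n M) n x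

theorem projExteriorPower_mul_of_lt {n k : ℕ} (h : n < k) {x : ExteriorAlgebra R M}
    (hx : x ∈ ⋀[R]^k M) (y : ExteriorAlgebra R M) : projExteriorPower R M n (x * y) = 0 :=
  Subtype.ext <| DirectSum.coe_decompose_mul_of_left_mem_of_not_le
    (𝒜 := fun n : ℕ => ⋀[R]^n M) hx (not_le.mpr h)

/-- The component in a given bidegree of `toGradedTensorProduct`. -/
noncomputable def bidegreeComponent (r : L →ₗ[R] M) (g : L →ₗ[R] N) (i n : ℕ) :
    ExteriorAlgebra R L →ₗ[R] (⋀[R]^i M) ⊗[R] (⋀[R]^n N) :=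
  TensorProduct.map (projExteriorPower R M i) (projExteriorPower R N n) ∘ₗ
    (GradedTensorProduct.of R (fun n : ℕ => ⋀[R]^n M) (fun n : ℕ => ⋀[R]^n N)).symm.toLinearMap ∘ₗ
      (toGradedTensorProduct r g).toLinearMap

theorem bidegreeComponent_map_mul_map {r : L →ₗ[R] M} {g : L →ₗ[R] N} {f : M →ₗ[R] L}
    {s : N →ₗ[R] L} (hrf : r ∘ₗ f = .id) (hgf : g ∘ₗ f = 0) (hrs : r ∘ₗ s = 0)
    (hgs : g ∘ₗ s = .id) {i n : ℕ} (x : ⋀[R]^i M) (y : ⋀[R]^n N) :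
    bidegreeComponent r g i n (map f x * map s y) = x ⊗ₜ y := by
  simp only [bidegreeComponent, LinearMap.comp_apply, AlgHom.toLinearMap_apply, map_mul,
    toGradedTensorProduct_map_left hrf hgf, toGradedTensorProduct_map_right hrs hgs,
    tmul_one_mul_one_tmul, LinearEquiv.coe_coe, of_symm_of, TensorProduct.map_tmul,
    projExteriorPower_coe]

theorem bidegreeComponent_map_mul_of_lt {r : L →ₗ[R] M} {g : L →ₗ[R] N} {f : M →ₗ[R] L}
    (hrf : r ∘ₗ f = .id) (hgf : g ∘ₗ f = 0) {i k : ℕ} (h : i < k) (n : ℕ)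
    {x : ExteriorAlgebra R M} (hx : x ∈ ⋀[R]^k M) (z : ExteriorAlgebra R L) :
    bidegreeComponent r g i n (map f x * z) = 0 := by
  simp only [bidegreeComponent, LinearMap.comp_apply, AlgHom.toLinearMap_apply, map_mul,
    toGradedTensorProduct_map_left hrf hgf]
  generalize toGradedTensorProduct r g z = t
  obtain ⟨t, rfl⟩ := (GradedTensorProduct.of R _ _).surjective t
  induction t using TensorProduct.induction_on with
  | zero => simp
  | add t u ht hu => simp only [map_add, mul_add, ht, hu, add_zero]
  | tmul a b =>
    have hab : (x ᵍ⊗ₜ[R] 1 * a ᵍ⊗ₜ[R] b :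
        (fun n : ℕ => ⋀[R]^n M) ᵍ⊗[R] (fun n : ℕ => ⋀[R]^n N)) = (x * a) ᵍ⊗ₜ[R] b := by
      rw [← tmul_one_mul_one_tmul _ _ a b, ← mul_assoc, ← tmul_one_mul_one_tmul _ _ (x * a) b]
      exact congrArg (· * _) (map_mul (includeLeft _ _) x a).symm
    rw [hab, LinearEquiv.coe_coe, of_symm_of, TensorProduct.map_tmul,
      projExteriorPower_mul_of_lt h hx, zero_tmul]

/-- The `i`-th step of the Koszul filtration on the `j`-th exterior power of the target of `f`. -/
noncomputable def koszulFiltration (f : M →ₗ[R] L) (j i : ℕ) :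
    Submodule R (ExteriorAlgebra R L) :=
  if i ≤ j then (⋀[R]^i M).map (map f).toLinearMap * ⋀[R]^(j - i) L else ⊥

theorem koszulFiltration_succ_le (f : M →ₗ[R] L) (j i : ℕ) :
    koszulFiltration f j (i + 1) ≤ koszulFiltration f j i := by
  unfold koszulFiltration
  split_ifs with h₁ h₂
  · obtain ⟨n, rfl⟩ := Nat.exists_eq_add_of_le h₁
    rw [map_map_exteriorPower, map_map_exteriorPower, show i + 1 + n - (i + 1) = n by omega,
      show i + 1 + n - i = n + 1 by omega, pow_succ, mul_assoc]
    refine mul_le_mul_right ?_ _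
    rw [exteriorPower, exteriorPower, pow_succ']
    exact mul_le_mul_left LinearMap.map_le_range _
  · omega
  · exact bot_le
  · exact bot_le

theorem koszulFiltration_le_sup {f : M →ₗ[R] L} {s : N →ₗ[R] L}
    (hfs : LinearMap.range f ⊔ LinearMap.range s = ⊤) {i j : ℕ} (hij : i ≤ j) :
    koszulFiltration f j i ≤
      (⋀[R]^i M).map (map f).toLinearMap * (⋀[R]^(j - i) N).map (map s).toLinearMap ⊔
        koszulFiltration f j (i + 1) := by
  have htop : (LinearMap.range f).map (ι R) ⊔ (LinearMap.range s).map (ι R) =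
      LinearMap.range (ι R (M := L)) := by
    rw [← Submodule.map_sup, hfs, Submodule.map_top]
  obtain ⟨n, rfl⟩ := Nat.exists_eq_add_of_le hij
  rw [koszulFiltration, if_pos hij, map_map_exteriorPower, map_map_exteriorPower,
    Nat.add_sub_cancel_left]
  cases n with
  | zero => simp [exteriorPower]
  | succ n =>
    rw [koszulFiltration, if_pos (by omega), map_map_exteriorPower,
      show i + (n + 1) - (i + 1) = n by omega, pow_succ _ i, mul_assoc, ← Submodule.mul_sup,
      exteriorPower, exteriorPower, ← htop]
    exact mul_le_mul_right (Submodule.sup_pow_le _ _ (map_ι_mul_map_ι_le _ _) n) _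

/-- For a split short exact sequence, the graded pieces of the Koszul filtration are tensor
products of exterior powers. -/
theorem nonempty_koszulFiltration_quotient_equiv {r : L →ₗ[R] M} {g : L →ₗ[R] N}
    {f : M →ₗ[R] L} {s : N →ₗ[R] L} (hrf : r ∘ₗ f = .id) (hgf : g ∘ₗ f = 0) (hrs : r ∘ₗ s = 0)
    (hgs : g ∘ₗ s = .id) (hfs : LinearMap.range f ⊔ LinearMap.range s = ⊤) {i j : ℕ}
    (hij : i ≤ j) :
    Nonempty ((koszulFiltration f j i ⧸
      (koszulFiltration f j (i + 1)).comap (koszulFiltration f j i).subtype) ≃ₗ[R]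
        (⋀[R]^i M) ⊗[R] (⋀[R]^(j - i) N)) := by
  have hkill : ∀ z ∈ koszulFiltration f j (i + 1), bidegreeComponent r g i (j - i) z = 0 := by
    intro z hz
    unfold koszulFiltration at hz
    split_ifs at hz
    · refine Submodule.mul_induction_on hz ?_ fun a b ha hb => by rw [map_add, ha, hb, add_zero]
      rintro _ ⟨x, hx, rfl⟩ y -
      exact bidegreeComponent_map_mul_of_lt hrf hgf i.lt_succ_self _ hx y
    · rw [(Submodule.mem_bot R).mp hz, map_zero]
  have hmem : ∀ (x : ⋀[R]^i M) (y : ⋀[R]^(j - i) N),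
      map f x * map s y ∈ koszulFiltration f j i := by
    intro x y
    rw [koszulFiltration, if_pos hij]
    refine Submodule.mul_mem_mul (Submodule.mem_map_of_mem x.2) ?_
    have h := Submodule.mem_map_of_mem (f := (map s).toLinearMap) y.2
    rw [map_map_exteriorPower] at h
    exact pow_le_pow_left' LinearMap.map_le_range _ h
  let φ : (⋀[R]^i M) ⊗[R] (⋀[R]^(j - i) N) →ₗ[R] ExteriorAlgebra R L :=
    TensorProduct.lift ((LinearMap.mul R (ExteriorAlgebra R L)).compl₁₂
      ((map f).toLinearMap ∘ₗ Submodule.subtype _) ((map s).toLinearMap ∘ₗ Submodule.subtype _))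
  have hφ : ∀ (x : ⋀[R]^i M) (y : ⋀[R]^(j - i) N), φ (x ⊗ₜ y) = map f x * map s y :=
    fun x y => rfl
  have hφmem : ∀ t, φ t ∈ koszulFiltration f j i := fun t => by
    induction t using TensorProduct.induction_on with
    | zero => simp
    | add t u ht hu => rw [map_add]; exact add_mem ht hu
    | tmul x y => exact hmem x y
  have hleft : bidegreeComponent r g i (j - i) ∘ₗ φ = .id := by
    ext x y : 3
    exact bidegreeComponent_map_mul_map hrf hgf hrs hgs _ _
  have hrange : (⋀[R]^i M).map (map f).toLinearMap * (⋀[R]^(j - i) N).map (map s).toLinearMap ≤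
      LinearMap.range φ := by
    rw [Submodule.mul_le]
    rintro _ ⟨x, hx, rfl⟩ _ ⟨y, hy, rfl⟩
    exact ⟨⟨x, hx⟩ ⊗ₜ ⟨y, hy⟩, rfl⟩
  refine ⟨(LinearEquiv.ofBijective
    (Submodule.mkQ _ ∘ₗ φ.codRestrict (koszulFiltration f j i) hφmem) ⟨?_, ?_⟩).symm⟩
  · rw [injective_iff_map_eq_zero]
    intro t ht
    have h : φ t ∈ koszulFiltration f j (i + 1) := by
      simpa using ht
    exact (LinearMap.congr_fun hleft t).symm.trans (hkill _ h)
  · intro q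
    obtain ⟨⟨z, hz⟩, rfl⟩ := Submodule.mkQ_surjective _ q
    obtain ⟨_, hu, v, hv, huv⟩ := Submodule.mem_sup.mp (koszulFiltration_le_sup hfs hij hz)
    obtain ⟨t, rfl⟩ := hrange hu
    refine ⟨t, (Submodule.Quotient.eq _).mpr ?_⟩
    have h : φ t - z = -v := by rw [← huv]; abel
    simpa [h] using hv

end ExteriorAlgebra

end KoszulFiltration

/-- For a short exact sequence `0 → M' → M → M'' → 0` of
`R`-modules with `M'`, `M''` finite free, the Koszul filtration
`K^i(∧^j M) = im((∧^i M') ⊗ (∧^{j−i} M) → ∧^j M)` (with `K^i = 0` for `i > j`)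
satisfies `K^{i+1}(∧^j M) ⊆ K^i(∧^j M)` for `0 ≤ i ≤ j`, with quotient
`K^i/K^{i+1} ≅ (∧^i M') ⊗_R (∧^{j−i} M'')`.  Exterior powers are realised as
submodules of the exterior algebra, and the image above is the submodule
product `(Λf)(⋀^i M') * ⋀^{j-i} M`. -/
theorem stmt_9 (R : Type*) [CommRing R]
    (M' M M'' : Type*) [AddCommGroup M'] [AddCommGroup M] [AddCommGroup M'']
    [Module R M'] [Module R M] [Module R M'']
    [Module.Finite R M'] [Module.Free R M'] [Module.Finite R M''] [Module.Free R M'']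
    (f : M' →ₗ[R] M) (g : M →ₗ[R] M'')
    (hf : Function.Injective f) (hg : Function.Surjective g)
    (hfg : LinearMap.range f = LinearMap.ker g)
    (i j : ℕ) (hij : i ≤ j) :
    let K : ℕ → Submodule R (ExteriorAlgebra R M) := fun a =>
      if a ≤ j then
        Submodule.map (ExteriorAlgebra.map f).toLinearMap (⋀[R]^a M') * (⋀[R]^(j - a) M)
      else ⊥
    K (i + 1) ≤ K i ∧
      Nonempty ((K i ⧸ Submodule.comap (K i).subtype (K (i + 1))) ≃ₗ[R]
        TensorProduct R (⋀[R]^i M') (⋀[R]^(j - i) M'')) := by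
  intro K
  obtain ⟨s, hgs⟩ := Module.projective_lifting_property g LinearMap.id hg
  have hgf : g ∘ₗ f = 0 := LinearMap.range_le_ker_iff.mp hfg.le
  have hgs' : ∀ y, g (s y) = y := LinearMap.congr_fun hgs
  have hgf' : ∀ x, g (f x) = 0 := LinearMap.congr_fun hgf
  have hmem : ∀ m, (LinearMap.id - s ∘ₗ g : M →ₗ[R] M) m ∈ LinearMap.range f := fun m => by
    simp [hfg, hgs']
  let r : M →ₗ[R] M' := (LinearEquiv.ofInjective f hf).symm.toLinearMap ∘ₗ
    (LinearMap.id - s ∘ₗ g : M →ₗ[R] M).codRestrict (LinearMap.range f) hmem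
  have hfr : ∀ m, f (r m) = m - s (g m) := fun m =>
    congrArg Subtype.val ((LinearEquiv.ofInjective f hf).apply_symm_apply ⟨_, hmem m⟩)
  have hrf : r ∘ₗ f = .id := LinearMap.ext fun x => hf <| by simp [hfr, hgf']
  have hrs : r ∘ₗ s = 0 := LinearMap.ext fun y => hf <| by simp [hfr, hgs']
  have hfs : LinearMap.range f ⊔ LinearMap.range s = ⊤ := eq_top_iff.mpr fun m _ =>
    Submodule.mem_sup.mpr ⟨f (r m), ⟨_, rfl⟩, s (g m), ⟨_, rfl⟩, by simp [hfr]⟩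
  exact ⟨koszulFiltration_succ_le f j i,
    nonempty_koszulFiltration_quotient_equiv hrf hgf hrs hgs hfs hij⟩
end

section
/- The Koszul filtration is compatible with the multiplication of the exterior algebra: for all integers i, i', a, a' with 0 ≤ i ≤ a and 0 ≤ i' ≤ a', the exterior product of any element of K^i(∧^a M) with any element of K^{i'}(∧^{a'} M) lies in K^{i+i'}(∧^{a+a'} M). -/
open ExteriorAlgebra

theorem Submodule.mul_pow_le_pow_mul {R A : Type*} [CommSemiring R] [Semiring A] [Algebra R A]
    {V W : Submodule R A} (h : V * W ≤ W * V) (q : ℕ) : V * W ^ q ≤ W ^ q * V := by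
  induction q with
  | zero => simp
  | succ q ih =>
    calc V * W ^ (q + 1) = V * W ^ q * W := by rw [pow_succ, mul_assoc]
      _ ≤ W ^ q * V * W := by gcongr
      _ = W ^ q * (V * W) := mul_assoc _ _ _
      _ ≤ W ^ q * (W * V) := by gcongr
      _ = W ^ (q + 1) * V := by rw [pow_succ, mul_assoc]

theorem Submodule.pow_mul_pow_le_pow_mul_pow {R A : Type*} [CommSemiring R] [Semiring A]
    [Algebra R A] {V W : Submodule R A} (h : V * W ≤ W * V) (p q : ℕ) :
    V ^ p * W ^ q ≤ W ^ q * V ^ p := by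
  induction p with
  | zero => simp
  | succ p ih =>
    calc V ^ (p + 1) * W ^ q = V ^ p * (V * W ^ q) := by rw [pow_succ, mul_assoc]
      _ ≤ V ^ p * (W ^ q * V) := by
        gcongr V ^ p * ?_
        exact mul_pow_le_pow_mul h q
      _ = V ^ p * W ^ q * V := (mul_assoc _ _ _).symm
      _ ≤ W ^ q * V ^ p * V := by gcongr
      _ = W ^ q * V ^ (p + 1) := by rw [pow_succ, mul_assoc]

/-- The image under `ExteriorAlgebra.map f` of an exterior power is a power of the image of the
degree one part. -/
theorem ExteriorAlgebra.map_exteriorPower {R M N : Type*} [CommRing R] [AddCommGroup M]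
    [AddCommGroup N] [Module R M] [Module R N] (f : M →ₗ[R] N) (n : ℕ) :
    Submodule.map (ExteriorAlgebra.map f).toLinearMap (⋀[R]^n M) =
      (LinearMap.range (ι R ∘ₗ f)) ^ n := by
  rw [← ExteriorAlgebra.map_comp_ι, LinearMap.range_comp]
  exact Submodule.map_pow _ _ n

theorem ExteriorAlgebra.range_ι_mul_range_le {R M N : Type*} [CommRing R] [AddCommGroup M]
    [AddCommGroup N] [Module R M] [Module R N] (f : M →ₗ[R] N) :
    LinearMap.range (ι R (M := N)) * LinearMap.range (ι R ∘ₗ f) ≤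
      LinearMap.range (ι R ∘ₗ f) * LinearMap.range (ι R (M := N)) := by
  rw [Submodule.mul_le]
  rintro _ ⟨x, rfl⟩ _ ⟨y, rfl⟩
  rw [LinearMap.comp_apply, eq_neg_of_add_eq_zero_left (ι_add_mul_swap x (f y))]
  exact neg_mem (Submodule.mul_mem_mul ⟨y, rfl⟩ ⟨x, rfl⟩)

/-- The Koszul filtration is compatible with the multiplication
of the exterior algebra: for `0 ≤ i ≤ a` and `0 ≤ i' ≤ a'`, the exterior
product of an element of `K^i(∧^a M)` with an element of `K^{i'}(∧^{a'} M)`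
lies in `K^{i+i'}(∧^{a+a'} M)`.  Exterior powers are realised as submodules of
the exterior algebra, `K^i(∧^a M)` being the submodule product
`(Λf)(⋀^i M') * ⋀^{a-i} M`. -/
theorem stmt_10 (R : Type*) [CommRing R]
    (M' M M'' : Type*) [AddCommGroup M'] [AddCommGroup M] [AddCommGroup M'']
    [Module R M'] [Module R M] [Module R M'']
    [Module.Finite R M'] [Module.Free R M'] [Module.Finite R M''] [Module.Free R M'']
    (f : M' →ₗ[R] M) (g : M →ₗ[R] M'')
    (hf : Function.Injective f) (hg : Function.Surjective g)
    (hfg : LinearMap.range f = LinearMap.ker g)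
    (i i' a a' : ℕ) (hia : i ≤ a) (hia' : i' ≤ a') :
    let K : ℕ → ℕ → Submodule R (ExteriorAlgebra R M) := fun b c =>
      Submodule.map (ExteriorAlgebra.map f).toLinearMap (⋀[R]^b M') * (⋀[R]^(c - b) M)
    ∀ x ∈ K i a, ∀ y ∈ K i' a', x * y ∈ K (i + i') (a + a') := by
  intro K x hx y hy
  simp only [K, map_exteriorPower] at hx hy ⊢
  set V := LinearMap.range (ι R (M := M))
  set W := LinearMap.range (ι R ∘ₗ f)
  have hVW : V * W ≤ W * V := range_ι_mul_range_le f
  have hle : W ^ i * V ^ (a - i) * (W ^ i' * V ^ (a' - i')) ≤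
      W ^ (i + i') * V ^ (a + a' - (i + i')) := by
    rw [show a + a' - (i + i') = (a - i) + (a' - i') by omega]
    calc W ^ i * V ^ (a - i) * (W ^ i' * V ^ (a' - i'))
        = W ^ i * (V ^ (a - i) * W ^ i') * V ^ (a' - i') := by simp only [mul_assoc]
      _ ≤ W ^ i * (W ^ i' * V ^ (a - i)) * V ^ (a' - i') := by
        gcongr W ^ i * ?_ * V ^ (a' - i')
        exact Submodule.pow_mul_pow_le_pow_mul_pow hVW _ _
      _ = W ^ (i + i') * V ^ ((a - i) + (a' - i')) := by simp only [pow_add, mul_assoc]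
  exact hle (Submodule.mul_mem_mul hx hy)
end

section
/- For every k, the graded piece of the tensor product filtration decomposes as gr^k(M ⊗_R N) ≅ ⊕_{i+j=k} gr^i(M) ⊗_R gr^j(N). -/
open scoped TensorProduct DirectSum

/-- The `i`-th graded piece of a filtration. -/
abbrev gradedPiece {R M : Type*} [CommRing R] [AddCommGroup M] [Module R M]
    (F : ℕ → Submodule R M) (i : ℕ) : Type _ :=
  ↥(F i) ⧸ Submodule.comap (F i).subtype (F (i + 1))

/-- A finite filtration with projective graded pieces splits: the module is the direct sum of
the graded pieces, compatibly with the filtrations. -/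
theorem exists_equiv_directSum_gradedPiece {R M : Type*} [CommRing R] [AddCommGroup M]
    [Module R M] (r : ℕ) (F : ℕ → Submodule R M) (h0 : F 0 = ⊤)
    (hdesc : ∀ i, F (i + 1) ≤ F i) (hr : F (r + 1) = ⊥)
    (hproj : ∀ i, Module.Projective R (gradedPiece F i)) :
    ∃ e : M ≃ₗ[R] ⨁ i, gradedPiece F i,
      ∀ i x, x ∈ F i ↔ ∀ j < i, e x j = 0 := by
  classical
  have hanti : Antitone F := antitone_nat_of_succ_le hdesc
  have hsec : ∀ i, ∃ s : gradedPiece F i →ₗ[R] F i,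
      (Submodule.mkQ _) ∘ₗ s = LinearMap.id := fun i =>
    Module.projective_lifting_property _ _ (Submodule.mkQ_surjective _)
  choose s hs using hsec
  have hs' : ∀ i a, Submodule.Quotient.mk (s i a) = a := fun i a =>
    LinearMap.congr_fun (hs i) a
  let φ : (⨁ i, gradedPiece F i) →ₗ[R] M :=
    DirectSum.toModule R ℕ M fun i => (F i).subtype ∘ₗ s i
  have hφ : ∀ i a, φ (DirectSum.lof R ℕ (gradedPiece F) i a) = s i a := fun i a => by
    simp [φ, DirectSum.toModule_lof]
  have hmem : ∀ i (x : ⨁ i, gradedPiece F i), (∀ j < i, x j = 0) → φ x ∈ F i := by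
    intro i x hx
    rw [← DirectSum.sum_support_of x, map_sum]
    refine Submodule.sum_mem _ fun j hj => ?_
    have hij : i ≤ j := by
      by_contra! h
      exact (DFinsupp.mem_support_iff.mp hj) (hx j h)
    exact hanti hij ((hφ j (x j)).symm ▸ (s j (x j)).2)
  have hlead : ∀ i (x : ⨁ i, gradedPiece F i), (∀ j < i, x j = 0) →
      φ x - s i (x i) ∈ F (i + 1) := by
    intro i x hx
    rw [← hφ, ← map_sub]
    refine hmem _ _ fun j hj => ?_
    rw [DirectSum.sub_apply, DirectSum.lof_eq_of]
    rcases Nat.lt_succ_iff_lt_or_eq.mp hj with h | rfl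
    · rw [hx j h, DirectSum.of_eq_of_ne _ _ _ h.ne, sub_zero]
    · rw [DirectSum.of_eq_same, sub_self]
  have hinj : Function.Injective φ := by
    rw [injective_iff_map_eq_zero]
    intro x hx
    refine DFinsupp.ext fun i => ?_
    induction i using Nat.strong_induction_on with
    | _ i ih =>
      have h := hlead i x ih
      rw [hx, zero_sub, Submodule.neg_mem_iff] at h
      rw [← hs' i (x i)]
      exact (Submodule.Quotient.mk_eq_zero _).mpr h
  have hex : ∀ n i, r + 1 ≤ i + n → ∀ m ∈ F i,
      ∃ x : ⨁ i, gradedPiece F i, (∀ j < i, x j = 0) ∧ φ x = m := by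
    intro n
    induction n with
    | zero =>
      intro i hi m hm
      have : m ∈ F (r + 1) := hanti (by omega) hm
      rw [hr, Submodule.mem_bot] at this
      exact ⟨0, fun _ _ => rfl, by rw [this, map_zero]⟩
    | succ n ih =>
      intro i hi m hm
      let a : gradedPiece F i := Submodule.Quotient.mk ⟨m, hm⟩
      have hma : m - s i a ∈ F (i + 1) :=
        (Submodule.Quotient.eq (Submodule.comap (F i).subtype (F (i + 1)))).mp (hs' i a).symm
      obtain ⟨y, hy, hym⟩ := ih (i + 1) (by omega) _ hma
      refine ⟨y + DirectSum.lof R ℕ (gradedPiece F) i a, fun j hj => ?_, ?_⟩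
      · rw [DirectSum.add_apply, hy j (by omega), DirectSum.lof_eq_of,
          DirectSum.of_eq_of_ne _ _ _ hj.ne, add_zero]
      · rw [map_add, hym, hφ, sub_add_cancel]
  have hsurj : Function.Surjective φ := fun m => by
    obtain ⟨x, -, hx⟩ := hex (r + 1) 0 (by omega) m (h0 ▸ Submodule.mem_top)
    exact ⟨x, hx⟩
  let e : (⨁ i, gradedPiece F i) ≃ₗ[R] M := LinearEquiv.ofBijective φ ⟨hinj, hsurj⟩
  refine ⟨e.symm, fun i m => ⟨fun hm => ?_, fun hm => ?_⟩⟩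
  · obtain ⟨x, hx, rfl⟩ := hex (r + 1) i (by omega) m hm
    rwa [show e.symm (φ x) = x from e.symm_apply_apply x]
  · rw [← e.apply_symm_apply m]
    exact hmem i _ hm

/-- The components of a pure tensor of elements of two direct sums. -/
theorem directSum_tmul_apply {R : Type*} [CommRing R] {ι κ : Type*} [DecidableEq ι]
    [DecidableEq κ] {A : ι → Type*} {B : κ → Type*} [∀ i, AddCommGroup (A i)]
    [∀ i, AddCommGroup (B i)] [∀ i, Module R (A i)] [∀ i, Module R (B i)]
    (x : ⨁ i, A i) (y : ⨁ i, B i) (p : ι × κ) :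
    TensorProduct.directSum R R A B (x ⊗ₜ y) p = x p.1 ⊗ₜ[R] y p.2 := by
  induction x using DirectSum.induction_on with
  | zero => simp
  | add x x' hx hx' =>
    rw [TensorProduct.add_tmul, map_add, DirectSum.add_apply, hx, hx', DirectSum.add_apply,
      TensorProduct.add_tmul]
  | of i a =>
    induction y using DirectSum.induction_on with
    | zero => simp
    | add y y' hy hy' =>
      rw [TensorProduct.tmul_add, map_add, DirectSum.add_apply, hy, hy', DirectSum.add_apply,
        TensorProduct.tmul_add]
    | of j b =>
      rw [← DirectSum.lof_eq_of R, ← DirectSum.lof_eq_of R, TensorProduct.directSum_lof_tmul_lof,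
        DirectSum.lof_eq_of, DirectSum.lof_eq_of, DirectSum.lof_eq_of]
      by_cases h : p = (i, j)
      · subst h
        simp only [DirectSum.of_eq_same]
      · rw [DirectSum.of_eq_of_ne _ _ _ h]
        by_cases hi : p.1 = i
        · rw [DirectSum.of_eq_of_ne j p.2 b fun hj => h (Prod.ext hi hj),
            TensorProduct.tmul_zero]
        · rw [DirectSum.of_eq_of_ne i p.1 a hi, TensorProduct.zero_tmul]

/-- Membership in the tensor product of two split filtrations is the vanishing of the components
of total degree less than `k`. -/
theorem mem_tensorFiltration_iff {R M N : Type*} [CommRing R] [AddCommGroup M]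
    [AddCommGroup N] [Module R M] [Module R N]
    {A B : ℕ → Type*} [∀ i, AddCommGroup (A i)] [∀ i, AddCommGroup (B i)]
    [∀ i, Module R (A i)] [∀ i, Module R (B i)]
    (FM : ℕ → Submodule R M) (FN : ℕ → Submodule R N)
    (e : M ≃ₗ[R] ⨁ i, A i) (f : N ≃ₗ[R] ⨁ i, B i)
    (he : ∀ i x, x ∈ FM i ↔ ∀ j < i, e x j = 0)
    (hf : ∀ i x, x ∈ FN i ↔ ∀ j < i, f x j = 0) (k : ℕ) (z : M ⊗[R] N) :
    z ∈ (⨆ (i : ℕ) (_ : i ≤ k),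
        LinearMap.range (TensorProduct.map (FM i).subtype (FN (k - i)).subtype)) ↔
      ∀ p : ℕ × ℕ, p.1 + p.2 < k →
        (TensorProduct.congr e f ≪≫ₗ TensorProduct.directSum R R A B) z p = 0 := by
  classical
  set T := TensorProduct.congr e f ≪≫ₗ TensorProduct.directSum R R A B with hT
  have hTtmul : ∀ m n (p : ℕ × ℕ), T (m ⊗ₜ n) p = e m p.1 ⊗ₜ[R] f n p.2 := fun m n p => by
    rw [hT, LinearEquiv.trans_apply, TensorProduct.congr_tmul, directSum_tmul_apply]
  constructor
  · intro hz p hp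
    let K : Submodule R (M ⊗[R] N) :=
      LinearMap.ker (DirectSum.component R (ℕ × ℕ) (fun p => A p.1 ⊗[R] B p.2) p ∘ₗ T.toLinearMap)
    suffices h : _ ≤ K from h hz
    refine iSup₂_le fun i hi => ?_
    rintro _ ⟨w, rfl⟩
    induction w with
    | zero => simp
    | add x y hx hy => rw [map_add]; exact K.add_mem hx hy
    | tmul x y =>
      change T ((x : M) ⊗ₜ (y : N)) p = 0
      rw [hTtmul]
      by_cases h : p.1 < i
      · rw [(he i x).mp x.2 _ h, TensorProduct.zero_tmul]
      · rw [(hf (k - i) y).mp y.2 _ (by omega), TensorProduct.tmul_zero]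
  · intro hz
    rw [← T.symm_apply_apply z, ← DirectSum.sum_support_of (T z), map_sum]
    refine Submodule.sum_mem _ fun p hp => ?_
    have hkp : k ≤ p.1 + p.2 := by
      by_contra! h
      exact (DFinsupp.mem_support_iff.mp hp) (hz p h)
    generalize T z p = c
    induction c with
    | zero => simp
    | add x y hx hy => rw [map_add, map_add]; exact Submodule.add_mem _ hx hy
    | tmul a b =>
      have hsymm : T.symm (DirectSum.of (fun p : ℕ × ℕ => A p.1 ⊗[R] B p.2) p (a ⊗ₜ b)) =
          e.symm (DirectSum.of A p.1 a) ⊗ₜ f.symm (DirectSum.of B p.2 b) := by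
        rw [LinearEquiv.symm_apply_eq, hT, LinearEquiv.trans_apply, TensorProduct.congr_tmul,
          LinearEquiv.apply_symm_apply, LinearEquiv.apply_symm_apply]
        exact (TensorProduct.directSum_lof_tmul_lof R R p.1 a p.2 b).symm
      rw [hsymm]
      have hM : e.symm (DirectSum.of A p.1 a) ∈ FM (min p.1 k) := by
        refine (he _ _).mpr fun j hj => ?_
        rw [LinearEquiv.apply_symm_apply, DirectSum.of_eq_of_ne _ _ _ (by omega)]
      have hN : f.symm (DirectSum.of B p.2 b) ∈ FN (k - min p.1 k) := by
        refine (hf _ _).mpr fun j hj => ?_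
        rw [LinearEquiv.apply_symm_apply, DirectSum.of_eq_of_ne _ _ _ (by omega)]
      exact Submodule.mem_iSup_of_mem (min p.1 k) (Submodule.mem_iSup_of_mem (min_le_right _ _)
        ⟨⟨_, hM⟩ ⊗ₜ ⟨_, hN⟩, rfl⟩)

/-- If `F` is the filtration of a bigraded module by total degree, then the `k`-th graded piece
of `F` is the sum of the components of total degree `k`. -/
theorem nonempty_gradedPiece_equiv {R V : Type*} [CommRing R] [AddCommGroup V] [Module R V]
    {C : ℕ × ℕ → Type*} [∀ p, AddCommGroup (C p)] [∀ p, Module R (C p)]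
    (F : ℕ → Submodule R V) (T : V ≃ₗ[R] ⨁ p, C p)
    (hF : ∀ k z, z ∈ F k ↔ ∀ p : ℕ × ℕ, p.1 + p.2 < k → T z p = 0) (k : ℕ) :
    Nonempty (gradedPiece F k ≃ₗ[R] ⨁ i : Fin (k + 1), C ((i : ℕ), k - (i : ℕ))) := by
  let D : Fin (k + 1) → Type _ := fun i => C ((i : ℕ), k - (i : ℕ))
  let h : F k →ₗ[R] ∀ i, D i :=
    LinearMap.pi fun i : Fin (k + 1) =>
      DirectSum.component R (ℕ × ℕ) C ((i : ℕ), k - (i : ℕ)) ∘ₗ T.toLinearMap ∘ₗ (F k).subtype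
  have hh : ∀ z i, h z i = T z ((i : ℕ), k - (i : ℕ)) := fun _ _ => rfl
  have hker : LinearMap.ker h = Submodule.comap (F k).subtype (F (k + 1)) := by
    ext z
    rw [LinearMap.mem_ker, Submodule.mem_comap, hF, Submodule.subtype_apply]
    constructor
    · rintro hz ⟨i, j⟩ hp
      rcases Nat.lt_succ_iff_lt_or_eq.mp hp with hlt | heq
      · exact (hF k z).mp z.2 _ hlt
      · obtain rfl : j = k - i := by simp only at heq; omega
        have hi : i < k + 1 := by simp only at heq; omega
        exact congrFun hz ⟨i, hi⟩
    · intro hz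
      funext i
      exact hz ((i : ℕ), k - (i : ℕ)) (by have := i.2; simp only; omega)
  have hsurj : Function.Surjective h := by
    intro y
    let x : ⨁ p, C p := ∑ i : Fin (k + 1), DirectSum.of C ((i : ℕ), k - (i : ℕ)) (y i)
    have hx : ∀ p, x p = ∑ i : Fin (k + 1), DirectSum.of C ((i : ℕ), k - (i : ℕ)) (y i) p :=
      fun p => DFinsupp.finsetSum_apply Finset.univ
        (fun i : Fin (k + 1) => DirectSum.of C ((i : ℕ), k - (i : ℕ)) (y i)) p
    have hmem : T.symm x ∈ F k := by
      refine (hF _ _).mpr fun p hp => ?_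
      rw [T.apply_symm_apply, hx]
      refine Finset.sum_eq_zero fun i _ => DirectSum.of_eq_of_ne _ _ _ ?_
      rintro rfl
      have := i.2
      simp only at hp
      omega
    refine ⟨⟨T.symm x, hmem⟩, funext fun i => ?_⟩
    rw [hh, T.apply_symm_apply, hx, Finset.sum_eq_single i]
    · exact DirectSum.of_eq_same _ _
    · intro j _ hji
      refine DirectSum.of_eq_of_ne _ _ _ fun h => hji ?_
      exact Fin.ext (Prod.mk.inj h).1.symm
    · simp
  exact ⟨Submodule.quotEquivOfEq _ _ hker.symm ≪≫ₗ h.quotKerEquivOfSurjective hsurj ≪≫ₗ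
    (DirectSum.linearEquivFunOnFintype R (Fin (k + 1)) D).symm⟩

/-- For `R`-modules `M`, `N` with finite, separated, exhaustive
descending filtrations `F⁰M = M ⊇ ⋯ ⊇ F^{r+1}M = 0`, `F⁰N = N ⊇ ⋯ ⊇ F^{s+1}N = 0`
whose graded pieces `gr^i = F^i/F^{i+1}` are all finite free, the graded pieces
of the tensor product filtration `F^k(M ⊗ N) = Σ_{i+j=k} im(F^iM ⊗ F^jN → M ⊗ N)`
decompose as `gr^k(M ⊗ N) ≅ ⊕_{i+j=k} gr^i(M) ⊗ gr^j(N)` (the sum running over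
`i ∈ {0, …, k}`, `j = k - i`). -/
theorem stmt_11 (R : Type*) [CommRing R]
    (M N : Type*) [AddCommGroup M] [AddCommGroup N] [Module R M] [Module R N]
    (r s : ℕ) (FM : ℕ → Submodule R M) (FN : ℕ → Submodule R N)
    (hFM0 : FM 0 = ⊤) (hFMdesc : ∀ i, FM (i + 1) ≤ FM i) (hFMr : FM (r + 1) = ⊥)
    (hFN0 : FN 0 = ⊤) (hFNdesc : ∀ j, FN (j + 1) ≤ FN j) (hFNs : FN (s + 1) = ⊥)
    (hgrM : ∀ i, Module.Finite R
        (↥(FM i) ⧸ Submodule.comap (FM i).subtype (FM (i + 1))) ∧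
      Module.Free R (↥(FM i) ⧸ Submodule.comap (FM i).subtype (FM (i + 1))))
    (hgrN : ∀ j, Module.Finite R
        (↥(FN j) ⧸ Submodule.comap (FN j).subtype (FN (j + 1))) ∧
      Module.Free R (↥(FN j) ⧸ Submodule.comap (FN j).subtype (FN (j + 1)))) :
    let F : ℕ → Submodule R (M ⊗[R] N) := fun k =>
      ⨆ (i : ℕ) (_ : i ≤ k),
        LinearMap.range (TensorProduct.map (FM i).subtype (FN (k - i)).subtype)
    ∀ k : ℕ,
      Nonempty ((↥(F k) ⧸ Submodule.comap (F k).subtype (F (k + 1))) ≃ₗ[R]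
        ⨁ i : Fin (k + 1),
          (↥(FM (i : ℕ)) ⧸ Submodule.comap (FM (i : ℕ)).subtype (FM ((i : ℕ) + 1))) ⊗[R]
          (↥(FN (k - (i : ℕ))) ⧸
            Submodule.comap (FN (k - (i : ℕ))).subtype (FN (k - (i : ℕ) + 1)))) := by
  intro F k
  obtain ⟨e, he⟩ := exists_equiv_directSum_gradedPiece r FM hFM0 hFMdesc hFMr fun i =>
    have := (hgrM i).2
    Module.Projective.of_free
  obtain ⟨f, hf⟩ := exists_equiv_directSum_gradedPiece s FN hFN0 hFNdesc hFNs fun j =>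
    have := (hgrN j).2
    Module.Projective.of_free
  exact nonempty_gradedPiece_equiv
    (C := fun p : ℕ × ℕ => gradedPiece FM p.1 ⊗[R] gradedPiece FN p.2) F
    (TensorProduct.congr e f ≪≫ₗ
      TensorProduct.directSum R R (gradedPiece FM) (gradedPiece FN))
    (mem_tensorFiltration_iff FM FN e f he hf) k
end
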